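/- Let M be a finite monoid and h : Σ* → M a monoid homomorphism. For every context-free grammar G over Σ there exists a context-free grammar G' = ⟨V', Σ, P', S'⟩ with L(G') = L(G) and a function τ : (V' \ {S'}) → M such that for every nonterminal A ∈ V' \ {S'} and every w ∈ Σ*, if A ⇒*_{G'} w then h(w) = τ(A). -/

import Mathlib

namespace ContextFreeGrammar

variable {α M : Type} [Monoid M]

/-- The image in `M` of a symbol whose nonterminals are annotated with elements of `M`; the fresh
start symbol `none` has the dummy value `1`. -/
def symbolType {N : Type} (h : FreeMonoid α →* M) : Symbol α (Option (N × M)) → M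
  | .terminal a => h (FreeMonoid.of a)
  | .nonterminal (some x) => x.2
  | .nonterminal none => 1

/-- The product of the types of the symbols of a string. -/
def stringType {N : Type} (h : FreeMonoid α →* M) (u : List (Symbol α (Option (N × M)))) : M :=
  (u.map (symbolType h)).prod

/-- Erases the annotation; the fresh start symbol becomes the start symbol of `G`. -/
def eraseType (M : Type) (G : ContextFreeGrammar α) :
    Symbol α (Option (G.NT × M)) → Symbol α G.NT
  | .terminal a => .terminal a
  | .nonterminal (some x) => .nonterminal x.1
  | .nonterminal none => .nonterminal G.initial

/-- The rules of the annotated grammar. -/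
def typedRules (h : FreeMonoid α →* M) (G : ContextFreeGrammar α) :
    Set (ContextFreeRule α (Option (G.NT × M))) :=
  {r | (∃ m, r = ⟨none, [.nonterminal (some (G.initial, m))]⟩) ∨
    ∃ A, r.input = some (A, stringType h r.output) ∧ .nonterminal none ∉ r.output ∧
      ⟨A, r.output.map (eraseType M G)⟩ ∈ G.rules}

lemma finite_typedRules [Finite α] [Finite M] (h : FreeMonoid α →* M)
    (G : ContextFreeGrammar α) [Finite G.NT] : (typedRules h G).Finite := by
  have : Finite (Symbol α (Option (G.NT × M))) :=
    Finite.of_injective (β := α ⊕ Option (G.NT × M))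
      (fun s ↦ match s with | .terminal a => .inl a | .nonterminal x => .inr x)
      (by rintro (a | a) (b | b) <;> simp)
  let n := G.rules.sup (fun r ↦ r.output.length) + 1
  have hfin := (Set.finite_univ (α := Option (G.NT × M))).prod
    (List.finite_length_le (Symbol α (Option (G.NT × M))) n)
  refine (hfin.image fun x ↦ (⟨x.1, x.2⟩ : ContextFreeRule α _)).subset fun r hr ↦
    ⟨(r.input, r.output), ⟨Set.mem_univ _, ?_⟩, rfl⟩
  change r.output.length ≤ n
  rcases hr with ⟨m, rfl⟩ | ⟨A, -, -, hA⟩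
  · simp [n]
  · have := Finset.le_sup (f := fun r ↦ r.output.length) hA
    simp only [List.length_map] at this
    omega

/-- The grammar whose nonterminals are annotated with the image under `h` of the words they
derive, together with a fresh start symbol. -/
noncomputable abbrev typed [Finite α] [Finite M] (h : FreeMonoid α →* M)
    (G : ContextFreeGrammar α) [Finite G.NT] : ContextFreeGrammar α where
  NT := Option (G.NT × M)
  initial := none
  rules := (finite_typedRules h G).toFinset

lemma eraseType_terminals (M : Type) (G : ContextFreeGrammar α) (w : List α) :
    (w.map Symbol.terminal).map (eraseType M G) = w.map Symbol.terminal := by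
  simp [eraseType]

section stringType

variable {N : Type} (h : FreeMonoid α →* M)

lemma stringType_append (u v : List (Symbol α (Option (N × M)))) :
    stringType h (u ++ v) = stringType h u * stringType h v := by
  simp [stringType]

lemma stringType_terminals (w : List α) :
    stringType (N := N) h (w.map Symbol.terminal) = h (FreeMonoid.ofList w) := by
  induction w with
  | nil => simp [stringType]
  | cons a w ih =>
    rw [FreeMonoid.ofList_cons, map_mul, ← ih]
    simp [stringType, symbolType]

end stringType

section typed

variable [Finite α] [Finite M] {h : FreeMonoid α →* M} {G : ContextFreeGrammar α} [Finite G.NT]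

lemma mem_rules_typed {r : ContextFreeRule α (Option (G.NT × M))} :
    r ∈ (typed h G).rules ↔ r ∈ typedRules h G :=
  (finite_typedRules h G).mem_toFinset

lemma Derives.eraseType {u v : List (Symbol α (Option (G.NT × M)))}
    (huv : (typed h G).Derives u v) :
    G.Derives (u.map (eraseType M G)) (v.map (eraseType M G)) := by
  induction huv with
  | refl => rfl
  | tail _ hstep ih =>
    refine ih.trans ?_
    obtain ⟨r, hr, hrw⟩ := hstep
    obtain ⟨p, q, rfl, rfl⟩ := hrw.exists_parts
    rcases mem_rules_typed.1 hr with ⟨m, rfl⟩ | ⟨A, hin, -, hA⟩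
    · simp only [List.map_append]
      rfl
    · refine Produces.single ⟨_, hA, ?_⟩
      rw [hin]
      simp only [List.map_append]
      exact ContextFreeRule.rewrites_of_exists_parts _ _ _

lemma Derives.stringType_eq {u v : List (Symbol α (Option (G.NT × M)))}
    (huv : (typed h G).Derives u v) (hu : .nonterminal none ∉ u) :
    .nonterminal none ∉ v ∧ stringType h v = stringType h u := by
  induction huv with
  | refl => exact ⟨hu, rfl⟩
  | tail _ hstep ih =>
    obtain ⟨hb, hub⟩ := ih
    rw [← hub]
    obtain ⟨r, hr, hrw⟩ := hstep
    obtain ⟨p, q, rfl, rfl⟩ := hrw.exists_parts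
    rcases mem_rules_typed.1 hr with ⟨m, rfl⟩ | ⟨A, hin, hout, -⟩
    · simp at hb
    · refine ⟨by simp_all, ?_⟩
      rw [hin]
      simp only [stringType_append]
      simp [stringType, symbolType]

lemma Derives.exists_typed {u : List (Symbol α G.NT)} {w : List α}
    (huw : G.Derives u (w.map Symbol.terminal)) :
    ∃ u' : List (Symbol α (Option (G.NT × M))), u'.map (ContextFreeGrammar.eraseType M G) = u ∧
      .nonterminal none ∉ u' ∧ (typed h G).Derives u' (w.map Symbol.terminal) := by
  induction huw using Relation.ReflTransGen.head_induction_on with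
  | refl => exact ⟨w.map Symbol.terminal, eraseType_terminals M G w, by simp, Derives.refl _⟩
  | head hstep _ ih =>
    obtain ⟨v', hv, hnone, hder⟩ := ih
    obtain ⟨r, hr, hrw⟩ := hstep
    obtain ⟨p, q, rfl, rfl⟩ := hrw.exists_parts
    obtain ⟨pr, q', rfl, hpr, rfl⟩ := List.map_eq_append_iff.1 hv
    obtain ⟨p', o, rfl, rfl, ho⟩ := List.map_eq_append_iff.1 hpr
    simp only [List.mem_append, not_or] at hnone
    refine ⟨p' ++ [.nonterminal (some (r.input, stringType h o))] ++ q', ?_, by simp [hnone],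
      Produces.trans_derives ⟨⟨some (r.input, stringType h o), o⟩, mem_rules_typed.2
        (Or.inr ⟨r.input, rfl, hnone.1.2, ?_⟩), ContextFreeRule.rewrites_of_exists_parts _ _ _⟩
        hder⟩
    · simp [ContextFreeGrammar.eraseType]
    · rw [ho]
      exact hr

variable (h G) in
lemma language_typed : (typed h G).language = G.language := by
  ext w
  simp only [mem_language_iff]
  refine ⟨fun hw ↦ ?_, fun hw ↦ ?_⟩
  · have := Derives.eraseType hw
    rwa [eraseType_terminals] at this
  · obtain ⟨u', hu, hnone, hder⟩ := hw.exists_typed (h := h)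
    obtain ⟨x, rfl, hx⟩ := List.map_eq_singleton_iff.1 hu
    rcases x with a | _ | ⟨A, m⟩
    · simp [eraseType] at hx
    · simp at hnone
    · obtain rfl : A = G.initial := by simpa [eraseType] using hx
      exact Produces.trans_derives
        ⟨_, mem_rules_typed.2 (Or.inl ⟨m, rfl⟩), ContextFreeRule.Rewrites.input_output⟩ hder

end typed

end ContextFreeGrammar


/-- Typing lemma: every CFG (with finitely many nonterminals) is equivalent to a CFG `G'`
(with finitely many nonterminals) whose non-start nonterminals each derive only strings with a
fixed image under a homomorphism `h` into a finite monoid. -/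
theorem cfg_typing_lemma {α : Type} [Fintype α] (M : Type) [Monoid M] [Finite M]
    (h : FreeMonoid α →* M) (G : ContextFreeGrammar α) [Fintype G.NT] :
    ∃ G' : ContextFreeGrammar α, Finite G'.NT ∧ G'.language = G.language ∧
      ∃ τ : G'.NT → M, ∀ A : G'.NT, A ≠ G'.initial → ∀ w : List α,
        G'.Derives [Symbol.nonterminal A] (w.map Symbol.terminal) →
          h (FreeMonoid.ofList w) = τ A := by
  refine ⟨G.typed h, inferInstanceAs (Finite (Option (G.NT × M))), G.language_typed h,
    fun A ↦ ContextFreeGrammar.symbolType h (.nonterminal A), ?_⟩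
  intro A hA w hw
  have hA' : Symbol.nonterminal none ∉ [(Symbol.nonterminal A : Symbol α (Option (G.NT × M)))] := by
    simpa using Ne.symm hA
  rw [← ContextFreeGrammar.stringType_terminals (N := G.NT), (hw.stringType_eq hA').2]
  simp [ContextFreeGrammar.stringType]
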